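/- arXiv:2011.13737 — 4 statements merged into one kernel-verified Lean document; each statement's English description precedes it below -/
import Mathlib

section
/- Let d ≥ 1 be an integer and φ a real number such that |dφ| ≤ π/3. Then cos(dφ) ≤ (cos φ)^d. -/
/-- For `0 ≤ x` with `d * x ≤ π / 2`, the cosine of the multiple is at most the power. -/
theorem cos_nat_mul_le_cos_pow_of_nonneg (d : ℕ) (x : ℝ) (hx : 0 ≤ x)
    (h : (d : ℝ) * x ≤ Real.pi / 2) : Real.cos ((d : ℝ) * x) ≤ Real.cos x ^ d := by
  induction d with
  | zero => simp
  | succ n ih =>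
    push_cast at h ⊢
    have hnx : 0 ≤ (n : ℝ) * x := by positivity
    have hπ := Real.pi_pos
    have hcos : 0 ≤ Real.cos x := Real.cos_nonneg_of_mem_Icc ⟨by linarith, by linarith⟩
    have hsin : 0 ≤ Real.sin x := Real.sin_nonneg_of_nonneg_of_le_pi hx (by linarith)
    have hsin' : 0 ≤ Real.sin (n * x) := Real.sin_nonneg_of_nonneg_of_le_pi hnx (by linarith)
    calc Real.cos ((n + 1) * x)
        = Real.cos (n * x) * Real.cos x - Real.sin (n * x) * Real.sin x := by
          rw [add_mul, one_mul, Real.cos_add]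
      _ ≤ Real.cos (n * x) * Real.cos x := sub_le_self _ (mul_nonneg hsin' hsin)
      _ ≤ Real.cos x ^ n * Real.cos x := mul_le_mul_of_nonneg_right (ih (by linarith)) hcos
      _ = Real.cos x ^ (n + 1) := (pow_succ _ _).symm

/-- for an integer d ≥ 1 and |dφ| ≤ π/3, cos(dφ) ≤ (cos φ)^d. -/
theorem stmt_5 (d : ℕ) (hd : 1 ≤ d) (φ : ℝ)
    (hφ : |(d : ℝ) * φ| ≤ Real.pi / 3) :
    Real.cos ((d : ℝ) * φ) ≤ (Real.cos φ) ^ d := by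
  have habs : |(d : ℝ) * φ| = d * |φ| := by rw [abs_mul, Nat.abs_cast]
  rw [← Real.cos_abs ((d : ℝ) * φ), ← Real.cos_abs φ, habs]
  exact cos_nat_mul_le_cos_pow_of_nonneg d |φ| (abs_nonneg φ)
    (by linarith [Real.pi_pos])
end

section
/- Let n ≥ 1 and d ≥ 1 be integers, and let x, y ∈ {0,1}^n be distinct strings whose Hamming distance satisfies |{ j : x_j ≠ y_j }| ≤ d. Then there exists an integer k with 0 ≤ k ≤ d-1 such that Σ_{j=0}^{n-1} C(j,k)·x_j ≠ Σ_{j=0}^{n-1} C(j,k)·y_j; in particular |Σ_{j=0}^{n-1} C(j,k)·(x_j - y_j)| ≥ 1. -/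
theorem choose_mul_sub_eq (j k : ℕ) (a : ℤ) :
    (j.choose k : ℤ) * (j - a) =
      (k + 1) * (j.choose (k + 1) : ℤ) + (k - a) * (j.choose k : ℤ) := by
  have h : (j.choose (k + 1) : ℤ) * (k + 1) = j.choose k * (j - k) := by
    rcases le_or_gt k j with hkj | hkj
    · have := Nat.choose_succ_right_eq j k
      zify [hkj] at this
      exact this
    · simp [Nat.choose_eq_zero_of_lt hkj, Nat.choose_eq_zero_of_lt (Nat.lt_succ_of_lt hkj)]
  linear_combination -h

/-- If the binomial moments of `c` of order below `d` vanish, then so do its moments against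
products of a binomial coefficient and linear factors of total degree below `d`. -/
theorem sum_choose_mul_prod_eq_zero {n d : ℕ} (c : Fin n → ℤ)
    (hc : ∀ k < d, ∑ j : Fin n, ((j : ℕ).choose k : ℤ) * c j = 0) (T : Finset (Fin n)) :
    ∀ k, T.card + k < d →
      ∑ j : Fin n, ((j : ℕ).choose k : ℤ) * (∏ i ∈ T, ((j : ℤ) - i)) * c j = 0 := by
  induction T using Finset.induction_on with
  | empty => intro k hk; simpa using hc k (by simpa using hk)
  | insert a T ha ih =>
    intro k hk
    rw [Finset.card_insert_of_notMem ha] at hk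
    calc ∑ j : Fin n, ((j : ℕ).choose k : ℤ) * (∏ i ∈ insert a T, ((j : ℤ) - i)) * c j
        = (k + 1) * (∑ j : Fin n,
              ((j : ℕ).choose (k + 1) : ℤ) * (∏ i ∈ T, ((j : ℤ) - i)) * c j) +
          (k - (a : ℤ)) * ∑ j : Fin n,
              ((j : ℕ).choose k : ℤ) * (∏ i ∈ T, ((j : ℤ) - i)) * c j := by
          rw [Finset.mul_sum, Finset.mul_sum, ← Finset.sum_add_distrib]
          refine Finset.sum_congr rfl fun j _ => ?_
          rw [Finset.prod_insert ha]
          linear_combination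
            (∏ i ∈ T, ((j : ℤ) - i)) * c j * choose_mul_sub_eq j k a
      _ = 0 := by rw [ih (k + 1) (by omega), ih k (by omega)]; ring

/-- A nonzero integer vector supported on a set of at most `d` indices has a nonzero binomial
moment of order below `d`. -/
theorem exists_sum_choose_mul_ne_zero {n d : ℕ} (c : Fin n → ℤ) (S : Finset (Fin n))
    (hS : ∀ j, j ∈ S ↔ c j ≠ 0) (hne : S.Nonempty) (hcard : S.card ≤ d) :
    ∃ k < d, ∑ j : Fin n, ((j : ℕ).choose k : ℤ) * c j ≠ 0 := by
  by_contra! hc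
  obtain ⟨a, ha⟩ := hne
  have hlt : (S.erase a).card + 0 < d := by
    have := Finset.card_erase_lt_of_mem ha
    omega
  have h := sum_choose_mul_prod_eq_zero c hc (S.erase a) 0 hlt
  rw [Finset.sum_eq_single a] at h
  · simp only [Nat.choose_zero_right, Nat.cast_one, one_mul, mul_eq_zero,
      Finset.prod_eq_zero_iff] at h
    rcases h with ⟨i, hi, hai⟩ | h
    · exact Finset.ne_of_mem_erase hi (Fin.ext (by omega))
    · exact (hS a).1 ha h
  · intro j _ hja
    by_cases hj : j ∈ S
    · rw [Finset.prod_eq_zero (Finset.mem_erase.2 ⟨hja, hj⟩) (sub_self _)]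
      ring
    · rw [not_not.1 (mt (hS j).2 hj), mul_zero]
  · simp

/-- distinct strings at Hamming distance at most d are separated
by some potential Φ_k(x) = Σ_j C(j,k) x_j with 0 ≤ k ≤ d-1. -/
theorem stmt_10 (n d : ℕ) (hn : 1 ≤ n) (hd : 1 ≤ d)
    (x y : Fin n → Bool) (hxy : x ≠ y)
    (hham : (Finset.univ.filter (fun j => x j ≠ y j)).card ≤ d) :
    ∃ k : ℕ, k ≤ d - 1 ∧
      (∑ j : Fin n, ((j : ℕ).choose k : ℤ) * (if x j then 1 else 0)) ≠
        (∑ j : Fin n, ((j : ℕ).choose k : ℤ) * (if y j then 1 else 0)) ∧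
      1 ≤ |∑ j : Fin n, ((j : ℕ).choose k : ℤ) *
            ((if x j then 1 else 0) - (if y j then 1 else 0))| := by
  obtain ⟨k, hk, hne⟩ := exists_sum_choose_mul_ne_zero
    (fun j => (if x j then 1 else 0) - (if y j then 1 else 0))
    (Finset.univ.filter (fun j => x j ≠ y j))
    (fun j => by cases hx : x j <;> cases hy : y j <;> simp [hx, hy])
    (by
      obtain ⟨j, hj⟩ := Function.ne_iff.1 hxy
      exact ⟨j, by simpa using hj⟩) hham
  refine ⟨k, by omega, fun h => hne ?_, Int.one_le_abs hne⟩
  simp only [mul_sub, Finset.sum_sub_distrib]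
  exact sub_eq_zero.2 h
end

section
/- Let p, q be real numbers with p + q = 1, let n ≥ 1 and k ≥ 0 be integers, and let x_0, …, x_{n-1} be real numbers. Define E_i(x) = Σ_{j=i}^{n-1} C(j,i)·p^{j-i}·q^{i+1}·x_j for 0 ≤ i ≤ n-1. Then Σ_{i=0}^{n-1} C(i,k)·E_i(x) = q^{k+1} · Σ_{j=0}^{n-1} C(j,k)·x_j. -/
/-- The binomial moments of a binomial distribution with parameters `j` and `q`. -/
theorem sum_range_choose_mul_choose_mul_pow {R : Type*} [CommSemiring R] {p q : R}
    (hpq : p + q = 1) (j k : ℕ) :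
    ∑ i ∈ Finset.range (j + 1), (i.choose k : R) * ((j.choose i : R) * p ^ (j - i) * q ^ i) =
      q ^ k * (j.choose k : R) := by
  obtain hjk | hkj := lt_or_ge j k
  · rw [Nat.choose_eq_zero_of_lt hjk, Nat.cast_zero, mul_zero]
    refine Finset.sum_eq_zero fun i hi => ?_
    have hik : i < k := by grind
    rw [Nat.choose_eq_zero_of_lt hik, Nat.cast_zero, zero_mul]
  · obtain ⟨d, rfl⟩ := Nat.exists_eq_add_of_le hkj
    rw [add_assoc, Finset.sum_range_add, Finset.sum_eq_zero, zero_add]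
    · have key : ∀ m, ((k + m).choose k : R) *
          (((k + d).choose (k + m) : R) * p ^ (k + d - (k + m)) * q ^ (k + m)) =
          q ^ k * ((k + d).choose k : R) * (q ^ m * p ^ (d - m) * (d.choose m : R)) := by
        intro m
        have h : ((k + d).choose (k + m) : R) * ((k + m).choose k : R) =
            ((k + d).choose k : R) * (d.choose m : R) := by
          have h' := Nat.choose_mul (n := k + d) (Nat.le_add_right k m)
          rw [Nat.add_sub_cancel_left, Nat.add_sub_cancel_left] at h'
          rw [← Nat.cast_mul, h', Nat.cast_mul]
        rw [Nat.add_sub_add_left, pow_add]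
        calc _ = ((k + d).choose (k + m) : R) * ((k + m).choose k : R) *
              (p ^ (d - m) * (q ^ k * q ^ m)) := by ring
          _ = _ := by rw [h]; ring
      simp_rw [key]
      rw [← Finset.mul_sum, ← add_pow, add_comm q p, hpq, one_pow, mul_one]
    · intro i hi
      rw [Nat.choose_eq_zero_of_lt (Finset.mem_range.mp hi), Nat.cast_zero, zero_mul]

/-- the expected potential identity
Σ_{i=0}^{n-1} C(i,k) E_i(x) = q^{k+1} Σ_{j=0}^{n-1} C(j,k) x_j, where
E_i(x) = Σ_{j=i}^{n-1} C(j,i) p^{j-i} q^{i+1} x_j and p + q = 1. -/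
theorem stmt_11 (p q : ℝ) (hpq : p + q = 1) (n : ℕ) (hn : 1 ≤ n) (k : ℕ)
    (x : ℕ → ℝ) :
    ∑ i ∈ Finset.range n, ((i.choose k : ℝ) *
        ∑ j ∈ Finset.Ico i n, ((j.choose i : ℝ) * p ^ (j - i) * q ^ (i + 1) * x j)) =
      q ^ (k + 1) * ∑ j ∈ Finset.range n, ((j.choose k : ℝ) * x j) := by
  simp_rw [Finset.mul_sum]
  rw [Finset.sum_comm' (t' := Finset.range n) (s' := fun j => Finset.range (j + 1))
    (by intro i j; simp only [Finset.mem_range, Finset.mem_Ico]; omega)]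
  refine Finset.sum_congr rfl fun j _ => ?_
  calc _ = (∑ i ∈ Finset.range (j + 1),
        (i.choose k : ℝ) * ((j.choose i : ℝ) * p ^ (j - i) * q ^ i)) * (q * x j) := by
        rw [Finset.sum_mul]
        exact Finset.sum_congr rfl fun i _ => by ring
    _ = _ := by rw [sum_range_choose_mul_choose_mul_pow hpq]; ring
end

section
/- Let x, y ∈ {0,1}^n be distinct strings with the same number of ones admitting a decomposition into d ≥ 1 blocks x = x_1 x_2 ⋯ x_d and y = y_1 y_2 ⋯ y_d (concatenations), where for each i the blocks x_i and y_i are strings of the same length ℓ_i ≥ 1 and satisfy one of: (1) x_i = y_i; (2) x_i = a·s, y_i = s·b for bits a, b and string s; (3) x_i = s·a, y_i = b·s for bits a, b and string s; (4) x_i = a·s, y_i = b·s for distinct bits a ≠ b and string s; (5) x_i = s·a, y_i = s·b for distinct bits a ≠ b and string s. Then (w-1)^{3d+1} does not divide the polynomial Q_x(w) - Q_y(w); that is, w = 1 is a root of Q_x - Q_y of multiplicity at most 3d. -/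
open Polynomial

/-- The polynomial over ℤ associated to a binary string,
Q_l(w) = Σ_{j=0}^{|l|-1} l_j w^j. -/
noncomputable def listPolyZ (l : List Bool) : Polynomial ℤ :=
  ∑ j ∈ Finset.range l.length, (if l.getD j false then (1 : Polynomial ℤ) else 0) * X ^ j

/-- The five admissible cases for a pair of blocks. -/
def BlockOK (u v : List Bool) : Prop :=
  u = v ∨
  (∃ (a b : Bool) (s : List Bool), u = a :: s ∧ v = s ++ [b]) ∨
  (∃ (a b : Bool) (s : List Bool), u = s ++ [a] ∧ v = b :: s) ∨
  (∃ (a b : Bool) (s : List Bool), a ≠ b ∧ u = a :: s ∧ v = b :: s) ∨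
  (∃ (a b : Bool) (s : List Bool), a ≠ b ∧ u = s ++ [a] ∧ v = s ++ [b])

/-- `CoeffMultiplier k m`: multiplying the coefficients of a polynomial pointwise by `m` lowers the
multiplicity of the root `1` by at most `k`. -/
def CoeffMultiplier (k : ℕ) (m : ℕ → ℤ) : Prop :=
  ∀ (F : ℤ[X]) (r : ℕ), (X - 1) ^ (r + k) ∣ F →
    ∃ G : ℤ[X], (X - 1) ^ r ∣ G ∧ ∀ j, G.coeff j = m j * F.coeff j

theorem CoeffMultiplier.one : CoeffMultiplier 0 fun _ => 1 :=
  fun F _ h => ⟨F, h, fun _ => (one_mul _).symm⟩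

theorem CoeffMultiplier.mono {k l : ℕ} {m : ℕ → ℤ} (h : CoeffMultiplier k m) (hkl : k ≤ l) :
    CoeffMultiplier l m :=
  fun F r hF => h F r ((pow_dvd_pow _ (by omega)).trans hF)

theorem CoeffMultiplier.mul_linear {k : ℕ} {m : ℕ → ℤ} (h : CoeffMultiplier k m) (a b : ℤ) :
    CoeffMultiplier (k + 1) fun j => m j * (a - b * j) := by
  intro F r hF
  obtain ⟨G, hG, hGF⟩ := h F (r + 1) (by convert hF using 2; omega)
  refine ⟨C a * G - C b * (X * derivative G), ?_, fun j => ?_⟩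
  · have h1 : (X - 1) ^ r ∣ derivative G := by
      simpa using pow_sub_one_dvd_derivative_of_pow_dvd hG
    exact dvd_sub (((pow_dvd_pow _ r.le_succ).trans hG).mul_left _) ((h1.mul_left _).mul_left _)
  · rcases j with _ | j
    · simp [hGF]; ring
    · simp [coeff_derivative, hGF]; ring

/-- The difference between the numbers of ones among the first `J` bits of `x` and of `y`. -/
def prefixDiff (x y : List Bool) (J : ℕ) : ℤ :=
  ((x.take J).count true : ℤ) - (y.take J).count true

theorem count_take_append_singleton (s : List Bool) (b : Bool) (J : ℕ) :
    (s.take J).count true ≤ ((s ++ [b]).take (J + 1)).count true ∧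
      ((s ++ [b]).take (J + 1)).count true ≤ (s.take J).count true + 1 := by
  induction s generalizing J with
  | nil => cases b <;> simp
  | cons c s ih =>
    rcases J with _ | J
    · cases c <;> simp
    · have := ih J
      cases c <;> simp at this ⊢ <;> omega

theorem count_take_append_singleton_self (s : List Bool) (b : Bool) (J : ℕ) :
    (s.take J).count true ≤ ((s ++ [b]).take J).count true ∧
      ((s ++ [b]).take J).count true ≤ (s.take J).count true + if b then 1 else 0 := by
  rw [List.take_append, List.count_append]
  have h : ([b].take (J - s.length)).count true ≤ [b].count true :=
    (List.take_sublist _ _).count_le _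
  cases b <;> simp at h ⊢ <;> omega

theorem prefixDiff_shift_range (a b : Bool) (s : List Bool) :
    (∀ J, 0 ≤ prefixDiff (a :: s) (s ++ [b]) J ∧ prefixDiff (a :: s) (s ++ [b]) J ≤ 1) ∨
      ∀ J, -1 ≤ prefixDiff (a :: s) (s ++ [b]) J ∧ prefixDiff (a :: s) (s ++ [b]) J ≤ 0 := by
  cases a
  · right
    rintro (_ | J)
    · simp [prefixDiff]
    · have := count_take_append_singleton s b J
      simp only [prefixDiff, List.take_succ_cons, List.count_cons]
      simp
      omega
  · left
    rintro (_ | J)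
    · simp [prefixDiff]
    · have := count_take_append_singleton s b J
      simp only [prefixDiff, List.take_succ_cons, List.count_cons]
      simp
      omega

theorem prefixDiff_swap (x y : List Bool) (J : ℕ) : prefixDiff y x J = -prefixDiff x y J := by
  simp [prefixDiff]

theorem BlockOK.prefixDiff_range {u v : List Bool} (h : BlockOK u v) :
    (∀ J, 0 ≤ prefixDiff u v J ∧ prefixDiff u v J ≤ 1) ∨
      ∀ J, -1 ≤ prefixDiff u v J ∧ prefixDiff u v J ≤ 0 := by
  rcases h with rfl | ⟨a, b, s, rfl, rfl⟩ | ⟨a, b, s, rfl, rfl⟩ | ⟨a, b, s, -, rfl, rfl⟩ |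
    ⟨a, b, s, hab, rfl, rfl⟩
  · simp [prefixDiff]
  · exact prefixDiff_shift_range a b s
  · simp only [prefixDiff_swap (b :: s)]
    rcases prefixDiff_shift_range b a s with h | h
    · right; intro J; have := h J; omega
    · left; intro J; have := h J; omega
  · cases a <;> cases b
    · simp [prefixDiff]
    · right; rintro (_ | J) <;> simp [prefixDiff]
    · left; rintro (_ | J) <;> simp [prefixDiff]
    · simp [prefixDiff]
  · have ha := count_take_append_singleton_self s a
    have hb := count_take_append_singleton_self s b
    unfold prefixDiff
    cases a <;> cases b <;> simp at hab ha hb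
    · right; intro J; have := ha J; have := hb J; omega
    · left; intro J; have := ha J; have := hb J; omega

/-- Since integers have no value strictly between `0` and `±1`, adding the prefix differences of an
admissible pair of blocks to a constant gives a sequence of constant weak sign. -/
theorem BlockOK.exists_sign {u v : List Bool} (h : BlockOK u v) (c : ℤ) :
    ∃ τ : ℤ, (τ = 1 ∨ τ = -1) ∧ ∀ J, 0 ≤ τ * (c + prefixDiff u v J) := by
  rcases h.prefixDiff_range with h | h
  · rcases le_or_gt 0 c with hc | hc
    · exact ⟨1, .inl rfl, fun J => by have := h J; omega⟩
    · exact ⟨-1, .inr rfl, fun J => by have := h J; omega⟩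
  · rcases lt_or_ge 0 c with hc | hc
    · exact ⟨1, .inl rfl, fun J => by have := h J; omega⟩
    · exact ⟨-1, .inr rfl, fun J => by have := h J; omega⟩

theorem prefixDiff_append_of_le {x y : List Bool} (hxy : x.length = y.length) (u v : List Bool)
    {J : ℕ} (hJ : J ≤ x.length) : prefixDiff (x ++ u) (y ++ v) J = prefixDiff x y J := by
  simp [prefixDiff, List.take_append_of_le_length hJ, List.take_append_of_le_length (hxy ▸ hJ)]

theorem prefixDiff_append_add {x y : List Bool} (hxy : x.length = y.length) (u v : List Bool)
    (J : ℕ) : prefixDiff (x ++ u) (y ++ v) (x.length + J) =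
      prefixDiff x y x.length + prefixDiff u v J := by
  have hy : (y ++ v).take (x.length + J) = y ++ v.take J := by
    rw [hxy, List.take_length_add_append]
  have hy' : y.take x.length = y := by rw [hxy, List.take_length]
  simp only [prefixDiff, hy, hy', List.take_length_add_append, List.take_length, List.count_append]
  push_cast
  ring

theorem length_flatten_eq {L : List (List Bool × List Bool)}
    (hL : ∀ p ∈ L, p.1.length = p.2.length) :
    (L.map Prod.fst).flatten.length = (L.map Prod.snd).flatten.length := by
  simp only [List.length_flatten, List.map_map]
  congr 1
  exact List.map_congr_left fun p hp => hL p hp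

/-- A multiplier whose signs match those of the prefix differences of a block decomposition. -/
theorem exists_coeffMultiplier (L : List (List Bool × List Bool))
    (hlen : ∀ p ∈ L, p.1.length = p.2.length) (hL : ∀ p ∈ L, BlockOK p.1 p.2) :
    ∃ (m : ℕ → ℤ) (σ : ℤ), CoeffMultiplier L.length m ∧ (σ = 1 ∨ σ = -1) ∧ (∀ J, m J ≠ 0) ∧
      (∀ J < (L.map Prod.fst).flatten.length,
        0 ≤ m J * prefixDiff (L.map Prod.fst).flatten (L.map Prod.snd).flatten J) ∧
      ∀ J, (L.map Prod.fst).flatten.length ≤ J → 0 < σ * m J := by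
  induction L using List.reverseRecOn with
  | nil => exact ⟨fun _ => 1, 1, .one, .inl rfl, by simp, by simp, by simp⟩
  | append_singleton L p ih =>
    have hlen' : ∀ p ∈ L, p.1.length = p.2.length := fun q hq => hlen q (by simp [hq])
    obtain ⟨m, σ, hm, hσ, hm0, hmx, hmσ⟩ := ih hlen' fun q hq => hL q (by simp [hq])
    have hxy := length_flatten_eq hlen'
    simp only [List.map_append, List.map_cons, List.map_nil, List.flatten_append,
      List.flatten_singleton, List.length_append, List.length_singleton]
    set x := (L.map Prod.fst).flatten
    set y := (L.map Prod.snd).flatten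
    obtain ⟨τ, hτ, hpos⟩ := (hL p (by simp)).exists_sign (prefixDiff x y x.length)
    have key : ∃ m' : ℕ → ℤ, CoeffMultiplier (L.length + 1) m' ∧ (∀ J, m' J ≠ 0) ∧
        (∀ J < x.length, ∃ c, 0 < c ∧ m' J = c * m J) ∧
        ∀ J, x.length ≤ J → 0 < τ * m' J := by
      by_cases hστ : τ = σ
      · exact ⟨m, hm.mono (Nat.le_succ _), hm0, fun J _ => ⟨1, one_pos, (one_mul _).symm⟩,
          fun J hJ => hστ ▸ hmσ J hJ⟩
      · have hστ' : τ = -σ := by omega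
        refine ⟨_, hm.mul_linear (2 * x.length - 1) 2, fun J => ?_, fun J hJ => ?_, fun J hJ => ?_⟩
        · exact mul_ne_zero (hm0 J) (by omega)
        · exact ⟨2 * x.length - 1 - 2 * J, by omega, mul_comm _ _⟩
        · have h1 := hmσ J hJ
          have h2 : (0 : ℤ) < 2 * J - (2 * x.length - 1) := by omega
          rw [hστ']
          linarith [mul_pos h1 h2]
    obtain ⟨m', hm', hm0', hc, hτm⟩ := key
    refine ⟨m', τ, hm', hτ, hm0', fun J _ => ?_, fun J hJ => hτm J (by omega)⟩
    rcases lt_or_ge J x.length with hJ | hJ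
    · obtain ⟨c, hc0, hcJ⟩ := hc J hJ
      rw [prefixDiff_append_of_le hxy _ _ hJ.le, hcJ, mul_assoc]
      exact mul_nonneg hc0.le (hmx J hJ)
    · obtain ⟨K, rfl⟩ := Nat.exists_eq_add_of_le hJ
      rw [prefixDiff_append_add hxy]
      have h1 := mul_nonneg (hτm _ hJ).le (hpos K)
      have h2 : τ * τ = 1 := by rcases hτ with rfl | rfl <;> rfl
      calc (0 : ℤ) ≤ _ := h1
        _ = (τ * τ) * (m' (x.length + K) *
            (prefixDiff x y x.length + prefixDiff p.1 p.2 K)) := by ring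
        _ = _ := by rw [h2, one_mul]

theorem coeff_listPolyZ (l : List Bool) (j : ℕ) :
    (listPolyZ l).coeff j = if l.getD j false then 1 else 0 := by
  have h (i : ℕ) : ((if l.getD i false then (1 : ℤ[X]) else 0) * X ^ i).coeff j =
      if j = i then (if l.getD i false then 1 else 0) else 0 := by
    split_ifs <;> simp_all [coeff_X_pow]
  simp only [listPolyZ, finsetSum_coeff, h, Finset.sum_ite_eq, Finset.mem_range]
  split_ifs with h1 h2 h2 <;> simp_all

theorem count_take_succ (l : List Bool) (J : ℕ) :
    (l.take (J + 1)).count true = (l.take J).count true + if l.getD J false then 1 else 0 := by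
  induction l generalizing J with
  | nil => simp
  | cons a l ih =>
    rcases J with _ | J
    · cases a <;> simp
    · have := ih J
      simp only [List.take_succ_cons, List.count_cons, List.getD_cons_succ] at this ⊢
      omega

theorem prefixDiff_succ (x y : List Bool) (J : ℕ) :
    prefixDiff x y (J + 1) = prefixDiff x y J + (listPolyZ x - listPolyZ y).coeff J := by
  simp only [prefixDiff, count_take_succ, coeff_sub, coeff_listPolyZ]
  push_cast
  ring

theorem eq_of_prefixDiff_eq_zero {x y : List Bool} (hxy : x.length = y.length)
    (h : ∀ J, prefixDiff x y J = 0) : x = y := by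
  refine List.ext_getElem hxy fun J hx hy => ?_
  have h1 := prefixDiff_succ x y J
  rw [h, h, coeff_sub, coeff_listPolyZ, coeff_listPolyZ, List.getD_eq_getElem _ _ hx,
    List.getD_eq_getElem _ _ hy] at h1
  revert h1
  cases x[J] <;> cases y[J] <;> simp

theorem coeff_X_mul_eq_neg_prefixDiff {x y : List Bool} {F : ℤ[X]}
    (hF : listPolyZ x - listPolyZ y = (X - 1) * F) (J : ℕ) :
    (X * F).coeff J = -prefixDiff x y J := by
  induction J with
  | zero => simp [prefixDiff]
  | succ J ih =>
    rw [prefixDiff_succ, hF, sub_mul, coeff_sub, ih, coeff_X_mul, one_mul]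
    ring

theorem eq_zero_of_dvd_of_coeff_nonneg {G : ℤ[X]} (h : X - 1 ∣ G) (hG : ∀ j, 0 ≤ G.coeff j) :
    G = 0 := by
  have h1 : G.eval 1 = 0 := by
    obtain ⟨H, rfl⟩ := h
    simp
  rw [eval_eq_sum_range] at h1
  simp only [one_pow, mul_one] at h1
  ext j
  rcases le_or_gt j G.natDegree with hj | hj
  · exact (Finset.sum_eq_zero_iff_of_nonneg fun i _ => hG i).1 h1 j (by simp; omega)
  · simp [coeff_eq_zero_of_natDegree_lt hj]

/-- for equal-weight strings with the special d-block
structure, w = 1 is a root of Q_x - Q_y of multiplicity at most 3d: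
(w-1)^{3d+1} does not divide Q_x - Q_y. -/
theorem stmt_15 (d n : ℕ) (hd : 1 ≤ d)
    (X' Y' : Fin d → List Bool) (x y : List Bool)
    (hlen : ∀ i : Fin d, 1 ≤ (X' i).length)
    (hleneq : ∀ i : Fin d, (X' i).length = (Y' i).length)
    (hblocks : ∀ i : Fin d, BlockOK (X' i) (Y' i))
    (hx : x = (List.ofFn X').flatten)
    (hy : y = (List.ofFn Y').flatten)
    (hxn : x.length = n) (hyn : y.length = n)
    (hne : x ≠ y)
    (hweight : x.count true = y.count true) :
    ¬ ((X - 1) ^ (3 * d + 1) ∣ (listPolyZ x - listPolyZ y)) := by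
  rintro ⟨H, hH⟩
  set L := List.ofFn fun i => (X' i, Y' i) with hLdef
  have hLx : (L.map Prod.fst).flatten = x := by rw [hx, hLdef, List.map_ofFn]; rfl
  have hLy : (L.map Prod.snd).flatten = y := by rw [hy, hLdef, List.map_ofFn]; rfl
  have hLd : L.length = d := by simp [hLdef]
  obtain ⟨m, σ, hm, -, hm0, hmx, -⟩ := exists_coeffMultiplier L
    (by simpa [hLdef, List.mem_ofFn] using hleneq)
    (by simpa [hLdef, List.mem_ofFn] using hblocks)
  rw [hLx, hLy] at hmx
  have hpos (J : ℕ) : 0 ≤ m J * prefixDiff x y J := by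
    rcases lt_or_ge J x.length with hJ | hJ
    · exact hmx J hJ
    · have : prefixDiff x y J = 0 := by
        rw [prefixDiff, List.take_of_length_le hJ, List.take_of_length_le (by omega), hweight,
          sub_self]
      simp [this]
  have hF : listPolyZ x - listPolyZ y = (X - 1) * ((X - 1) ^ (3 * d) * H) := by
    rw [hH, pow_succ']; ring
  have hcoeff := coeff_X_mul_eq_neg_prefixDiff hF
  obtain ⟨G, hG, hGF⟩ := hm (X * ((X - 1) ^ (3 * d) * H)) 1
    (((pow_dvd_pow _ (by omega)).mul_right H).mul_left X)
  have hG0 : -G = 0 := by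
    refine eq_zero_of_dvd_of_coeff_nonneg (by simpa using hG) fun j => ?_
    rw [coeff_neg, hGF, hcoeff]
    simpa using hpos j
  refine hne (eq_of_prefixDiff_eq_zero (hxn.trans hyn.symm) fun J => ?_)
  have h1 := hGF J
  rw [neg_eq_zero.1 hG0, coeff_zero, hcoeff] at h1
  simpa [hm0 J] using h1.symm
end
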